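/- Let L = L₀ ⊕ L₁ be a finite-dimensional nilpotent complex Leibniz superalgebra with dim L₀ = n ≥ 3 and dim L₁ = m ≥ 1. Assume: (i) for every x ∈ L₀ \ L₀², the restriction of R_x to L₀ satisfies (R_x|_{L₀})^{n−2} = 0 (i.e. the first entry n₁ of the characteristic sequence satisfies n₁ ≤ n−2); and (ii) there exists x ∈ L₀ \ L₀² such that (R_x|_{L₁})^{m−1} ≠ 0 and (R_x|_{L₁})^{m} = 0 (i.e. R_x acts on L₁ by a single Jordan block of size m, so the characteristic sequence has the form (n₁,…,n_k | m)). Then the nilindex of L is less than n + m; equivalently, L^{n+m−1} = 0. -/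

import Mathlib

/-- A complex Leibniz superalgebra structure on a vector space `V`:
a bilinear bracket together with an internal ℤ₂-grading `V = L0 ⊕ L1`
such that the bracket respects the grading and the Leibniz superidentity
`[x,[y,z]] = [[x,y],z] − (−1)^{αβ}[[x,z],y]` holds for homogeneous `y, z`. -/
structure LeibnizSuperAlg (V : Type*) [AddCommGroup V] [Module ℂ V] where
  br : V →ₗ[ℂ] V →ₗ[ℂ] V
  L0 : Submodule ℂ V
  L1 : Submodule ℂ V
  compl : IsCompl L0 L1
  grade00 : ∀ x ∈ L0, ∀ y ∈ L0, br x y ∈ L0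
  grade01 : ∀ x ∈ L0, ∀ y ∈ L1, br x y ∈ L1
  grade10 : ∀ x ∈ L1, ∀ y ∈ L0, br x y ∈ L1
  grade11 : ∀ x ∈ L1, ∀ y ∈ L1, br x y ∈ L0
  super_ee : ∀ (x : V), ∀ y ∈ L0, ∀ z ∈ L0,
    br x (br y z) = br (br x y) z - br (br x z) y
  super_eo : ∀ (x : V), ∀ y ∈ L0, ∀ z ∈ L1,
    br x (br y z) = br (br x y) z - br (br x z) y
  super_oe : ∀ (x : V), ∀ y ∈ L1, ∀ z ∈ L0,
    br x (br y z) = br (br x y) z - br (br x z) y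
  super_oo : ∀ (x : V), ∀ y ∈ L1, ∀ z ∈ L1,
    br x (br y z) = br (br x y) z + br (br x z) y

namespace LeibnizSuperAlg

variable {V : Type*} [AddCommGroup V] [Module ℂ V]

/-- The span of all products `[u,v]` with `u ∈ S`, `v ∈ T`. -/
def prodSpan (A : LeibnizSuperAlg V) (S T : Submodule ℂ V) : Submodule ℂ V :=
  Submodule.span ℂ {z : V | ∃ u ∈ S, ∃ v ∈ T, z = A.br u v}

/-- `A.lcs k` is the `(k+1)`-st term `L^{k+1}` of the descending central series:
`L¹ = L`, `L^{k+1} = [L^k, L]`. -/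
def lcs (A : LeibnizSuperAlg V) : ℕ → Submodule ℂ V
  | 0 => ⊤
  | k + 1 => A.prodSpan (lcs A k) ⊤

/-- `A.lcs0 k` is the `(k+1)`-st term `L₀^{k+1}` of the descending central series
of the even part: `L₀¹ = L₀`, `L₀^{k+1} = [L₀^k, L₀]`. -/
def lcs0 (A : LeibnizSuperAlg V) : ℕ → Submodule ℂ V
  | 0 => A.L0
  | k + 1 => A.prodSpan (lcs0 A k) A.L0

/-- Nilpotency: some term of the descending central series vanishes. -/
def IsNilpotent (A : LeibnizSuperAlg V) : Prop := ∃ s, A.lcs s = ⊥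

/-- `S` generates `L`: the smallest subspace containing `S` and closed under the
product is `L` itself. -/
def Generates (A : LeibnizSuperAlg V) (S : Set V) : Prop :=
  ∀ W : Submodule ℂ V, S ⊆ W → (∀ u ∈ W, ∀ v ∈ W, A.br u v ∈ W) → W = ⊤

/-- The operator of right multiplication `R_x : z ↦ [z, x]`. -/
def R (A : LeibnizSuperAlg V) (x : V) : V →ₗ[ℂ] V := A.br.flip x

end LeibnizSuperAlg

namespace LeibnizSuperAlg

section aux

variable {V : Type*} [AddCommGroup V] [Module ℂ V] (A : LeibnizSuperAlg V)

lemma br_mem_lcs {k : ℕ} {u : V} (hu : u ∈ A.lcs k) (v : V) : A.br u v ∈ A.lcs (k + 1) :=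
  Submodule.subset_span ⟨u, hu, v, Submodule.mem_top, rfl⟩

lemma lcs_succ_le {k : ℕ} {W : Submodule ℂ V} (h : ∀ u ∈ A.lcs k, ∀ v, A.br u v ∈ W) :
    A.lcs (k + 1) ≤ W := by
  refine Submodule.span_le.2 ?_
  rintro z ⟨u, hu, v, -, rfl⟩
  exact h u hu v

lemma mem_lcs_zero (v : V) : v ∈ A.lcs 0 := Submodule.mem_top

lemma lcs_succ_le_self (k : ℕ) : A.lcs (k + 1) ≤ A.lcs k := by
  induction k with
  | zero => exact fun v _ => A.mem_lcs_zero v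
  | succ k ih => exact A.lcs_succ_le fun u hu v => A.br_mem_lcs (ih hu) v

lemma lcs_anti : Antitone A.lcs := antitone_nat_of_succ_le A.lcs_succ_le_self

lemma lcs_mono {i j : ℕ} (h : i ≤ j) {v : V} (hv : v ∈ A.lcs j) : v ∈ A.lcs i :=
  A.lcs_anti h hv

lemma exists_comp (v : V) : ∃ a ∈ A.L0, ∃ b ∈ A.L1, v = a + b := by
  have : v ∈ A.L0 ⊔ A.L1 := by rw [A.compl.sup_eq_top]; trivial
  obtain ⟨a, ha, b, hb, h⟩ := Submodule.mem_sup.1 this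
  exact ⟨a, ha, b, hb, h.symm⟩

lemma zero_of_mem {v : V} (h0 : v ∈ A.L0) (h1 : v ∈ A.L1) : v = 0 := by
  have : v ∈ A.L0 ⊓ A.L1 := ⟨h0, h1⟩
  rw [A.compl.inf_eq_bot] at this
  simpa using this

lemma comp_unique {a a' b b' : V} (ha : a ∈ A.L0) (ha' : a' ∈ A.L0) (hb : b ∈ A.L1)
    (hb' : b' ∈ A.L1) (h : a + b = a' + b') : a = a' ∧ b = b' := by
  have e : a - a' = b' - b := by
    rw [sub_eq_sub_iff_add_eq_add, h, add_comm]
  have h0 : a - a' = 0 := A.zero_of_mem (sub_mem ha ha') (e ▸ sub_mem hb' hb)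
  have h1 : b' - b = 0 := e ▸ h0
  exact ⟨sub_eq_zero.1 h0, (sub_eq_zero.1 h1).symm⟩

lemma lcs_graded (k : ℕ) : ∀ v ∈ A.lcs k,
    ∃ a ∈ A.L0, a ∈ A.lcs k ∧ ∃ b ∈ A.L1, b ∈ A.lcs k ∧ v = a + b := by
  induction k with
  | zero =>
    intro v _
    obtain ⟨a, ha, b, hb, h⟩ := A.exists_comp v
    exact ⟨a, ha, A.mem_lcs_zero _, b, hb, A.mem_lcs_zero _, h⟩
  | succ k ih =>
    have : A.lcs (k + 1) ≤ (A.L0 ⊓ A.lcs (k + 1)) ⊔ (A.L1 ⊓ A.lcs (k + 1)) := by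
      refine A.lcs_succ_le fun u hu v => ?_
      obtain ⟨a, ha, hak, b, hb, hbk, rfl⟩ := ih u hu
      obtain ⟨c, hc, d, hd, rfl⟩ := A.exists_comp v
      refine Submodule.mem_sup.2 ⟨A.br a c + A.br b d,
        ⟨add_mem (A.grade00 a ha c hc) (A.grade11 b hb d hd),
          add_mem (A.br_mem_lcs hak _) (A.br_mem_lcs hbk _)⟩, A.br a d + A.br b c,
        ⟨add_mem (A.grade01 a ha d hd) (A.grade10 b hb c hc),
          add_mem (A.br_mem_lcs hak _) (A.br_mem_lcs hbk _)⟩, ?_⟩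
      simp only [map_add, LinearMap.add_apply]
      abel
    intro v hv
    obtain ⟨a, ha, b, hb, h⟩ := Submodule.mem_sup.1 (this hv)
    exact ⟨a, ha.1, ha.2, b, hb.1, hb.2, h.symm⟩

lemma br_mem_lcs_add (j : ℕ) : ∀ v ∈ A.lcs j, ∀ (i : ℕ), ∀ u ∈ A.lcs i,
    A.br u v ∈ A.lcs (i + j + 1) := by
  induction j with
  | zero => intro v _ i u hu; exact A.br_mem_lcs hu v
  | succ j ih =>
    intro v hv i u hu
    have key : A.lcs (j + 1) ≤ (A.lcs (i + (j + 1) + 1)).comap (A.br u) := by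
      refine A.lcs_succ_le fun a ha b => ?_
      have aux : ∀ a ∈ A.lcs j, ∀ b : V, A.br (A.br u a) b ∈ A.lcs (i + (j + 1) + 1) ∧
          A.br (A.br u b) a ∈ A.lcs (i + (j + 1) + 1) := by
        intro a ha b
        constructor
        · exact A.br_mem_lcs (ih a ha i u hu) b
        · have := ih a ha (i + 1) _ (A.br_mem_lcs hu b)
          rwa [show i + 1 + j + 1 = i + (j + 1) + 1 by ring] at this
      obtain ⟨a0, ha0, ha0', a1, ha1, ha1', rfl⟩ := A.lcs_graded j a ha
      obtain ⟨b0, hb0, b1, hb1, rfl⟩ := A.exists_comp b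
      simp only [Submodule.mem_comap, map_add, LinearMap.add_apply]
      rw [A.super_ee u a0 ha0 b0 hb0, A.super_eo u a0 ha0 b1 hb1,
        A.super_oe u a1 ha1 b0 hb0, A.super_oo u a1 ha1 b1 hb1]
      refine add_mem (add_mem ?_ ?_) (add_mem ?_ ?_)
      · exact sub_mem (aux a0 ha0' b0).1 (aux a0 ha0' b0).2
      · exact sub_mem (aux a1 ha1' b0).1 (aux a1 ha1' b0).2
      · exact sub_mem (aux a0 ha0' b1).1 (aux a0 ha0' b1).2
      · exact add_mem (aux a1 ha1' b1).1 (aux a1 ha1' b1).2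
    exact key hv

lemma br_mem {i j k : ℕ} {u v : V} (hu : u ∈ A.lcs i) (hv : v ∈ A.lcs j) (h : k ≤ i + j + 1) :
    A.br u v ∈ A.lcs k :=
  A.lcs_mono h (A.br_mem_lcs_add j v hv i u hu)

lemma even_part {k : ℕ} {a b : V} (ha : a ∈ A.L0) (hb : b ∈ A.L1) (h : a + b ∈ A.lcs k) :
    a ∈ A.lcs k ∧ b ∈ A.lcs k := by
  obtain ⟨a', ha', hak, b', hb', hbk, e⟩ := A.lcs_graded k _ h
  obtain ⟨rfl, rfl⟩ := A.comp_unique ha ha' hb hb' e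
  exact ⟨hak, hbk⟩

/-- Nilpotency: a submodule contained in every term is trivial. -/
lemma eq_bot_of_le (hnil : A.IsNilpotent) {W : Submodule ℂ V} (k : ℕ) (h0 : W ≤ A.lcs k)
    (h : ∀ j, k ≤ j → W ≤ A.lcs j → W ≤ A.lcs (j + 1)) : W = ⊥ := by
  obtain ⟨s, hs⟩ := hnil
  have : ∀ j, k ≤ j → W ≤ A.lcs j := by
    intro j hj
    induction j, hj using Nat.le_induction with
    | base => exact h0
    | succ j hj ih => exact h j hj ih
  have h2 := (this (max k s) (le_max_left _ _)).trans (A.lcs_anti (le_max_right k s))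
  rw [hs] at h2
  exact le_bot_iff.1 h2

/-- A nonzero submodule of `lcs k` lies in a last term. -/
lemma exists_last (hnil : A.IsNilpotent) {W : Submodule ℂ V} (hW : W ≠ ⊥) (k : ℕ)
    (h0 : W ≤ A.lcs k) : ∃ j, k ≤ j ∧ W ≤ A.lcs j ∧ ¬ W ≤ A.lcs (j + 1) := by
  by_contra hc
  push Not at hc
  exact hW (A.eq_bot_of_le hnil k h0 hc)

lemma lcs_stable (hnil : A.IsNilpotent) (k : ℕ) (h : A.lcs k ≤ A.lcs (k + 1)) :
    A.lcs k = ⊥ := by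
  refine A.eq_bot_of_le hnil k le_rfl fun j _ hj => ?_
  exact h.trans (A.lcs_succ_le fun u hu v => A.br_mem_lcs (hj hu) v)

/-- If `lcs (k+1) ≤ W + lcs (k+2)` etc. -/
lemma le_of_nakayama (hnil : A.IsNilpotent) {W : Submodule ℂ V} (k : ℕ)
    (h : ∀ j, k ≤ j → A.lcs j ≤ W ⊔ A.lcs (j + 1)) : A.lcs k ≤ W := by
  obtain ⟨s, hs⟩ := hnil
  have : ∀ j, k ≤ j → A.lcs k ≤ W ⊔ A.lcs j := by
    intro j hj
    induction j, hj using Nat.le_induction with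
    | base => exact le_sup_right
    | succ j hj ih => exact ih.trans (sup_le le_sup_left (h j hj))
  have h2 := this (max k s) (le_max_left _ _)
  have h3 : A.lcs (max k s) = ⊥ := le_bot_iff.1 (hs ▸ A.lcs_anti (le_max_right k s))
  rwa [h3, sup_bot_eq] at h2

/-- Generators. -/
lemma lcs_gen (hnil : A.IsNilpotent) (X Y : V)
    (hgen : ∀ v : V, ∃ (α β : ℂ) (w : V), w ∈ A.lcs 1 ∧ v = α • X + β • Y + w)
    (k : ℕ) : A.lcs (k + 1) ≤ (A.lcs k).map (A.R X) ⊔ (A.lcs k).map (A.R Y) := by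
  refine A.le_of_nakayama hnil (k + 1) fun j hj => ?_
  obtain ⟨j, rfl⟩ : ∃ i, j = i + 1 := ⟨j - 1, by omega⟩
  refine A.lcs_succ_le fun u hu v => ?_
  obtain ⟨α, β, w, hw, rfl⟩ := hgen v
  have huk : u ∈ A.lcs k := A.lcs_mono (by omega) hu
  rw [map_add, map_add, map_smul, map_smul]
  refine add_mem (Submodule.mem_sup_left (add_mem (Submodule.mem_sup_left ?_)
    (Submodule.mem_sup_right ?_))) (Submodule.mem_sup_right (A.br_mem hu hw (by omega)))
  · exact ⟨α • u, Submodule.smul_mem _ _ huk, by simp [R]⟩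
  · exact ⟨β • u, Submodule.smul_mem _ _ huk, by simp [R]⟩

lemma gen_even (hnil : A.IsNilpotent) {X Y : V} (hX : X ∈ A.L0) (hY : Y ∈ A.L1)
    (hgen : ∀ v : V, ∃ (α β : ℂ) (w : V), w ∈ A.lcs 1 ∧ v = α • X + β • Y + w)
    {k : ℕ} {v : V} (hv : v ∈ A.lcs (k + 1)) (hv0 : v ∈ A.L0) :
    ∃ a ∈ A.L0, a ∈ A.lcs k ∧ ∃ b ∈ A.L1, b ∈ A.lcs k ∧ v = A.br a X + A.br b Y := by
  obtain ⟨_, ⟨a, ha, rfl⟩, _, ⟨b, hb, rfl⟩, h⟩ :=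
    Submodule.mem_sup.1 (A.lcs_gen hnil X Y hgen k hv)
  obtain ⟨a0, ha0, hak, a1, ha1, -, rfl⟩ := A.lcs_graded k a ha
  obtain ⟨b0, hb0, -, b1, hb1, hbk, rfl⟩ := A.lcs_graded k b hb
  refine ⟨a0, ha0, hak, b1, hb1, hbk, ?_⟩
  refine (A.comp_unique (b := 0) (b' := A.br a1 X + A.br b0 Y) hv0
    (add_mem (A.grade00 _ ha0 _ hX) (A.grade11 _ hb1 _ hY)) (zero_mem _)
    (add_mem (A.grade10 _ ha1 _ hX) (A.grade01 _ hb0 _ hY)) ?_).1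
  rw [← h]
  simp only [R, LinearMap.flip_apply, map_add, LinearMap.add_apply]
  abel

lemma gen_odd (hnil : A.IsNilpotent) {X Y : V} (hX : X ∈ A.L0) (hY : Y ∈ A.L1)
    (hgen : ∀ v : V, ∃ (α β : ℂ) (w : V), w ∈ A.lcs 1 ∧ v = α • X + β • Y + w)
    {k : ℕ} {v : V} (hv : v ∈ A.lcs (k + 1)) (hv1 : v ∈ A.L1) :
    ∃ a ∈ A.L1, a ∈ A.lcs k ∧ ∃ b ∈ A.L0, b ∈ A.lcs k ∧ v = A.br a X + A.br b Y := by
  obtain ⟨_, ⟨a, ha, rfl⟩, _, ⟨b, hb, rfl⟩, h⟩ :=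
    Submodule.mem_sup.1 (A.lcs_gen hnil X Y hgen k hv)
  obtain ⟨a0, ha0, -, a1, ha1, hak, rfl⟩ := A.lcs_graded k a ha
  obtain ⟨b0, hb0, hbk, b1, hb1, -, rfl⟩ := A.lcs_graded k b hb
  refine ⟨a1, ha1, hak, b0, hb0, hbk, ?_⟩
  refine (A.comp_unique (a := 0) (a' := A.br a0 X + A.br b1 Y) (zero_mem _)
    (add_mem (A.grade00 _ ha0 _ hX) (A.grade11 _ hb1 _ hY)) hv1
    (add_mem (A.grade10 _ ha1 _ hX) (A.grade01 _ hb0 _ hY)) ?_).2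
  rw [← h]
  simp only [R, LinearMap.flip_apply, map_add, LinearMap.add_apply]
  abel

/-- `R_X` is a derivation for even `X`. -/
lemma der {X : V} (hX : X ∈ A.L0) (u v : V) :
    A.br (A.br u v) X = A.br (A.br u X) v + A.br u (A.br v X) := by
  obtain ⟨a, ha, b, hb, rfl⟩ := A.exists_comp v
  simp only [map_add, LinearMap.add_apply]
  rw [A.super_ee u a ha X hX, A.super_oe u b hb X hX]
  abel

lemma sq_odd {Y : V} (hY : Y ∈ A.L1) (u : V) :
    A.br u (A.br Y Y) = (2 : ℂ) • A.br (A.br u Y) Y := by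
  rw [A.super_oo u Y hY Y hY, two_smul]

/-- A cyclic nilpotent operator bounds the dimension. -/
lemma finrank_le_of_cyclic {M : Submodule ℂ V} (T : V →ₗ[ℂ] V) (u : V) (s : ℕ)
    (hM : ∀ v ∈ M, ∃ c : ℂ, ∃ w ∈ M, v = c • u + T w)
    (hs : ∀ z ∈ M, (T ^ s) z = 0) : Module.finrank ℂ M ≤ s := by
  have key : ∀ j, ∀ v ∈ M, ∃ p ∈ Submodule.span ℂ (Set.range fun i : Fin j => (T ^ (i : ℕ)) u),
      ∃ w ∈ M, v = p + (T ^ j) w := by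
    intro j
    induction j with
    | zero => intro v hv; exact ⟨0, zero_mem _, v, hv, by simp⟩
    | succ j ih =>
      intro v hv
      obtain ⟨p, hp, w, hw, rfl⟩ := ih v hv
      obtain ⟨c, w', hw', rfl⟩ := hM w hw
      refine ⟨p + c • (T ^ j) u, add_mem ?_ (Submodule.smul_mem _ _ (Submodule.subset_span
        ⟨Fin.last j, by simp⟩)), w', hw', ?_⟩
      · refine Submodule.span_mono ?_ hp
        rintro _ ⟨i, rfl⟩
        exact ⟨i.castSucc, by simp⟩
      · rw [map_add, map_smul, pow_succ, Module.End.mul_apply, add_assoc]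
  have hle : M ≤ Submodule.span ℂ (Set.range fun i : Fin s => (T ^ (i : ℕ)) u) := by
    intro v hv
    obtain ⟨p, hp, w, hw, rfl⟩ := key s v hv
    rwa [hs w hw, add_zero]
  have : FiniteDimensional ℂ (Submodule.span ℂ (Set.range fun i : Fin s => (T ^ (i : ℕ)) u)) :=
    FiniteDimensional.span_of_finite ℂ (Set.finite_range _)
  refine (Submodule.finrank_mono hle).trans ((finrank_range_le_card _).trans ?_)
  simp

/-- A nilpotent single Jordan block is cyclic. -/
lemma cyclic_of_pow_ne [FiniteDimensional ℂ V] {W : Submodule ℂ V} (T : V →ₗ[ℂ] V) (m : ℕ)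
    (hm : Module.finrank ℂ W = m) (hm1 : 1 ≤ m) (hT : ∀ w ∈ W, T w ∈ W) (z : V) (hz : z ∈ W)
    (hz1 : (T ^ (m - 1)) z ≠ 0) (hz0 : ∀ w ∈ W, (T ^ m) w = 0) :
    ∀ v ∈ W, ∃ c : ℂ, ∃ w ∈ W, v = c • z + T w := by
  have hTi : ∀ i, ∀ w ∈ W, (T ^ i) w ∈ W := by
    intro i
    induction i with
    | zero => intro w hw; simpa
    | succ i ih => intro w hw; rw [pow_succ, Module.End.mul_apply]; exact ih _ (hT w hw)
  have hbig : ∀ i, m ≤ i → (T ^ i) z = 0 := by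
    intro i hi
    rw [show i = (i - m) + m by omega, pow_add, Module.End.mul_apply, hz0 z hz, map_zero]
  let f : Fin m → W := fun i => ⟨(T ^ (i : ℕ)) z, hTi i z hz⟩
  have hli : LinearIndependent ℂ f := by
    rw [Fintype.linearIndependent_iff]
    intro g hg
    have hg' : ∑ i : Fin m, g i • (T ^ (i : ℕ)) z = 0 := by
      have := congrArg (Subtype.val) hg
      simpa [f] using this
    have : ∀ k : ℕ, ∀ i : Fin m, (i : ℕ) = k → g i = 0 := by
      intro k
      induction k using Nat.strong_induction_on with
      | _ k ih =>
        intro i hik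
        have h2 := congrArg (T ^ (m - 1 - k)) hg'
        rw [map_sum, map_zero, Finset.sum_eq_single i] at h2
        · rw [map_smul, ← Module.End.mul_apply, ← pow_add,
            show m - 1 - k + (i : ℕ) = m - 1 by omega] at h2
          exact (smul_eq_zero.1 h2).resolve_right hz1
        · intro b _ hb
          rcases lt_or_gt_of_ne (fun h => hb (Fin.ext h) : (b : ℕ) ≠ i) with h | h
          · rw [ih b (by omega) b rfl, zero_smul, map_zero]
          · rw [map_smul, ← Module.End.mul_apply, ← pow_add, hbig _ (by omega), smul_zero]
        · simp
    exact fun i => this i i rfl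
  have hspan : ⊤ ≤ Submodule.span ℂ (Set.range f) := by
    refine (hli.span_eq_top_of_card_eq_finrank' ?_).ge
    simp [hm]
  intro v hv
  have : Submodule.span ℂ (Set.range f) ≤
      (Submodule.span ℂ {z} ⊔ W.map T).comap W.subtype := by
    refine Submodule.span_le.2 ?_
    rintro _ ⟨⟨i, hi⟩, rfl⟩
    simp only [SetLike.mem_coe, Submodule.mem_comap, Submodule.subtype_apply, f]
    rcases i with _ | i
    · exact Submodule.mem_sup_left (by simp [Submodule.mem_span_singleton_self])
    · refine Submodule.mem_sup_right ⟨(T ^ i) z, hTi i z hz, ?_⟩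
      rw [pow_succ', Module.End.mul_apply]
  have h3 : v ∈ Submodule.span ℂ {z} ⊔ W.map T :=
    (hspan.trans this) (Submodule.mem_top : (⟨v, hv⟩ : W) ∈ ⊤)
  obtain ⟨_, hp, _, ⟨w, hw, rfl⟩, h⟩ := Submodule.mem_sup.1 h3
  obtain ⟨c, rfl⟩ := Submodule.mem_span_singleton.1 hp
  exact ⟨c, w, hw, h.symm⟩

/-- All successive quotients beyond the first are at most one-dimensional. -/
def ThinTail (A : LeibnizSuperAlg V) : Prop :=
  ∀ k, 1 ≤ k → ∀ u ∈ A.lcs k, u ∉ A.lcs (k + 1) → ∀ v ∈ A.lcs k, ∃ c : ℂ,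
    v - c • u ∈ A.lcs (k + 1)

/-- `X`, `Y` span the algebra modulo its square. -/
def Gen2 (A : LeibnizSuperAlg V) (X Y : V) : Prop :=
  ∀ v : V, ∃ (α β : ℂ) (w : V), w ∈ A.lcs 1 ∧ v = α • X + β • Y + w

variable {A}

lemma ThinTail.even {k : ℕ} (h : A.ThinTail) (hk : 1 ≤ k) {o v : V} (ho1 : o ∈ A.L1)
    (ho : o ∈ A.lcs k) (hon : o ∉ A.lcs (k + 1)) (hv0 : v ∈ A.L0) (hv : v ∈ A.lcs k) :
    v ∈ A.lcs (k + 1) := by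
  obtain ⟨c, hc⟩ := h k hk o ho hon v hv
  rw [sub_eq_add_neg] at hc
  exact (A.even_part hv0 (neg_mem (Submodule.smul_mem _ _ ho1)) hc).1

lemma ThinTail.odd {k : ℕ} (h : A.ThinTail) (hk : 1 ≤ k) {o v : V} (ho0 : o ∈ A.L0)
    (ho : o ∈ A.lcs k) (hon : o ∉ A.lcs (k + 1)) (hv1 : v ∈ A.L1) (hv : v ∈ A.lcs k) :
    v ∈ A.lcs (k + 1) := by
  obtain ⟨c, hc⟩ := h k hk o ho hon v hv
  rw [sub_eq_add_neg, add_comm v] at hc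
  exact (A.even_part (neg_mem (Submodule.smul_mem _ _ ho0)) hv1 hc).2

lemma Gen2.even {X Y : V} (h : A.Gen2 X Y) (hX : X ∈ A.L0) (hY : Y ∈ A.L1) {v : V}
    (hv : v ∈ A.L0) : ∃ α : ℂ, ∃ w ∈ A.L0, w ∈ A.lcs 1 ∧ v = α • X + w := by
  obtain ⟨α, β, w, hw, e⟩ := h v
  obtain ⟨w0, hw0, hw0', w1, hw1, -, rfl⟩ := A.lcs_graded 1 w hw
  refine ⟨α, w0, hw0, hw0', ?_⟩
  refine (A.comp_unique (b := 0) (b' := β • Y + w1) hv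
    (add_mem (Submodule.smul_mem _ _ hX) hw0) (zero_mem _)
    (add_mem (Submodule.smul_mem _ _ hY) hw1) ?_).1
  rw [add_zero, e]
  abel

lemma Gen2.odd {X Y : V} (h : A.Gen2 X Y) (hX : X ∈ A.L0) (hY : Y ∈ A.L1) {v : V}
    (hv : v ∈ A.L1) : ∃ β : ℂ, ∃ w ∈ A.L1, w ∈ A.lcs 1 ∧ v = β • Y + w := by
  obtain ⟨α, β, w, hw, e⟩ := h v
  obtain ⟨w0, hw0, -, w1, hw1, hw1', rfl⟩ := A.lcs_graded 1 w hw
  refine ⟨β, w1, hw1, hw1', ?_⟩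
  refine (A.comp_unique (a := 0) (a' := α • X + w0) (zero_mem _)
    (add_mem (Submodule.smul_mem _ _ hX) hw0) hv
    (add_mem (Submodule.smul_mem _ _ hY) hw1) ?_).2
  rw [zero_add, e]
  abel

variable (A) in
lemma lcs0_one_le {W : Submodule ℂ V} (h : ∀ u ∈ A.L0, ∀ v ∈ A.L0, A.br u v ∈ W) :
    A.lcs0 1 ≤ W := by
  refine Submodule.span_le.2 ?_
  rintro z ⟨u, hu, v, hv, rfl⟩
  exact h u hu v hv

variable (A) in
lemma R_apply (x z : V) : A.R x z = A.br z x := rfl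

/-- Case I, no odd elements in the square. -/
lemma case_one_bot [FiniteDimensional ℂ V] (hnil : A.IsNilpotent) {X Y : V} (hX : X ∈ A.L0)
    (hY : Y ∈ A.L1) (hX1 : X ∉ A.lcs 1) (hgen : A.Gen2 X Y) (hthin : A.ThinTail) (n : ℕ)
    (hn : 3 ≤ n) (hM : n ≤ Module.finrank ℂ (A.L0 ⊓ A.lcs 1 : Submodule ℂ V) + 1)
    (hchar0 : ∀ x ∈ A.L0, x ∉ A.lcs0 1 → ∀ z ∈ A.L0, ((A.R x) ^ (n - 2)) z = 0)
    (hO : ∀ o ∈ A.L1, o ∈ A.lcs 1 → o = 0) : False := by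
  have hX0 : X ∉ A.lcs0 1 := fun h => hX1 (A.lcs0_one_le
    (fun u _ v _ => A.br_mem_lcs (A.mem_lcs_zero u) v) h)
  have hne : ¬ A.lcs 1 ≤ A.lcs 2 := by
    intro h
    have := A.lcs_stable hnil 1 h
    rw [this, inf_bot_eq, finrank_bot] at hM
    omega
  obtain ⟨u, hu, hu2⟩ := SetLike.not_le_iff_exists.1 hne
  have := finrank_le_of_cyclic (M := A.L0 ⊓ A.lcs 1) (A.R X) u (n - 2) ?_
    (fun z hz => hchar0 X hX hX0 z hz.1)
  · omega
  rintro v ⟨hv0, hv⟩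
  have hu0 : u ∈ A.L0 := by
    obtain ⟨a, ha, -, b, hb, hb1, rfl⟩ := A.lcs_graded 1 u hu
    rw [hO b hb hb1, add_zero]; exact ha
  obtain ⟨c, hc⟩ := hthin 1 le_rfl u hu hu2 v hv
  obtain ⟨a, ha, ha1, b, hb, hb1, e⟩ := A.gen_even hnil hX hY hgen hc
    (sub_mem hv0 (Submodule.smul_mem _ _ hu0))
  refine ⟨c, a, ⟨ha, ha1⟩, ?_⟩
  rw [hO b hb hb1, map_zero, LinearMap.zero_apply, add_zero] at e
  rw [R_apply, ← e]
  abel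

/-- Case I. -/
lemma case_one [FiniteDimensional ℂ V] (hnil : A.IsNilpotent) {X Y : V} (hX : X ∈ A.L0)
    (hY : Y ∈ A.L1) (hX1 : X ∉ A.lcs 1) (hgen : A.Gen2 X Y) (hthin : A.ThinTail) (n : ℕ)
    (hn : 3 ≤ n) (hM : n ≤ Module.finrank ℂ (A.L0 ⊓ A.lcs 1 : Submodule ℂ V) + 1)
    (hchar0 : ∀ x ∈ A.L0, x ∉ A.lcs0 1 → ∀ z ∈ A.L0, ((A.R x) ^ (n - 2)) z = 0)
    (hO : ∀ o ∈ A.L1, o ∈ A.lcs 1 → o ∈ A.lcs 2) : False := by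
  by_cases hbot : A.L1 ⊓ A.lcs 1 = ⊥
  · refine case_one_bot hnil hX hY hX1 hgen hthin n hn hM hchar0 fun o ho ho1 => ?_
    have : o ∈ A.L1 ⊓ A.lcs 1 := ⟨ho, ho1⟩
    rw [hbot] at this
    simpa using this
  have hYX1 : A.br Y X ∈ A.L1 := A.grade10 _ hY _ hX
  have hYXs : A.br Y X ∈ A.lcs 1 := A.br_mem_lcs (A.mem_lcs_zero _) _
  -- the last term containing the odd part of the square
  obtain ⟨k, hk, hOk, hOk'⟩ := A.exists_last hnil hbot 2 (fun o ho => hO o ho.1 ho.2)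
  obtain ⟨o, ⟨ho1, hos⟩, hok⟩ := SetLike.not_le_iff_exists.1 hOk'
  have hk2 : k = 2 := by
    by_contra hne
    obtain ⟨j, rfl⟩ : ∃ j, k = j + 3 := ⟨k - 3, by omega⟩
    apply hok
    obtain ⟨a, ha, ha', b, hb, hb', rfl⟩ := A.gen_odd hnil hX hY hgen (hOk ⟨ho1, hos⟩) ho1
    have ha3 := hOk ⟨ha, A.lcs_mono (by omega) ha'⟩
    obtain ⟨c, hc, hc', d, hd, hd', rfl⟩ := A.gen_even hnil hX hY hgen hb' hb
    have hd3 := hOk ⟨hd, A.lcs_mono (by omega) hd'⟩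
    have hder := A.der hX c Y
    have hcY := hOk ⟨A.grade01 _ hc _ hY, A.lcs_mono (by omega) (A.br_mem_lcs hc' Y)⟩
    rw [map_add, LinearMap.add_apply, eq_sub_of_add_eq hder.symm]
    refine add_mem (A.br_mem_lcs ha3 _) (add_mem (sub_mem (A.br_mem_lcs hcY _) ?_) ?_)
    · exact A.br_mem hc' (hOk ⟨hYX1, hYXs⟩) (by omega)
    · exact A.br_mem_lcs (A.lcs_succ_le_self _ (A.br_mem_lcs hd3 _)) _
  subst hk2
  have hev : ∀ v ∈ A.L0, v ∈ A.lcs 2 → v ∈ A.lcs 3 := fun v hv hv2 =>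
    hthin.even (by norm_num) ho1 (hO o ho1 hos) hok hv hv2
  set W := A.br Y Y with hW
  set Z := A.br X X with hZ
  have hW0 : W ∈ A.L0 := A.grade11 _ hY _ hY
  have hZ0 : Z ∈ A.L0 := A.grade00 _ hX _ hX
  have hWs : W ∈ A.lcs 1 := A.br_mem_lcs (A.mem_lcs_zero _) _
  have hZs : Z ∈ A.lcs 1 := A.br_mem_lcs (A.mem_lcs_zero _) _
  have hYX2 : A.br Y X ∈ A.lcs 2 := hO _ hYX1 hYXs
  have hXY2 : A.br X Y ∈ A.lcs 2 :=
    hO _ (A.grade01 _ hX _ hY) (A.br_mem_lcs (A.mem_lcs_zero _) _)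
  have hZY : A.br Z Y ∈ A.lcs 3 := by
    have hder := A.der hX X Y
    rw [eq_sub_of_add_eq hder.symm]
    exact sub_mem (A.br_mem_lcs hXY2 _) (A.br_mem (A.mem_lcs_zero X) hYX2 (by omega))
  have hWY : A.br W Y ∉ A.lcs 3 := by
    intro hWY
    apply hok
    obtain ⟨a, ha, ha', b, hb, hb', rfl⟩ := A.gen_odd hnil hX hY hgen (hO o ho1 hos) ho1
    refine add_mem (A.br_mem_lcs (hO a ha ha') _) ?_
    obtain ⟨c, hc, -, d, hd, -, rfl⟩ := A.gen_even hnil hX hY hgen hb' hb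
    obtain ⟨α, c', hc0, hc1, rfl⟩ := hgen.even hX hY hc
    obtain ⟨β, d', hd0, hd1, rfl⟩ := hgen.odd hX hY hd
    simp only [map_add, map_smul, LinearMap.add_apply, LinearMap.smul_apply]
    refine add_mem (add_mem (Submodule.smul_mem _ _ hZY) ?_)
      (add_mem (Submodule.smul_mem _ _ hWY) ?_)
    · exact A.br_mem_lcs (A.br_mem_lcs hc1 _) _
    · exact A.br_mem_lcs (A.br_mem_lcs hd1 _) _
  have hW2 : W ∉ A.lcs 2 := fun h => hWY (A.br_mem_lcs h _)
  have hZ2 : Z ∈ A.lcs 2 := by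
    obtain ⟨c, hc⟩ := hthin 1 le_rfl W hWs hW2 Z hZs
    by_cases hc0 : c = 0
    · simpa [hc0] using hc
    exfalso
    apply hWY
    have h1 : A.br (Z - c • W) Y ∈ A.lcs 3 := A.br_mem_lcs hc _
    have h2 := sub_mem hZY h1
    simp only [map_sub, map_smul, LinearMap.sub_apply, LinearMap.smul_apply, sub_sub_cancel] at h2
    exact (Submodule.smul_mem_iff _ hc0).1 h2
  have hD : ∀ k, 1 ≤ k → ∀ v ∈ A.lcs k, A.br v X ∈ A.lcs (k + 2) := by
    intro k hk
    induction k, hk using Nat.le_induction with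
    | base =>
      intro v hv
      obtain ⟨a, ha, ha', b, hb, hb', rfl⟩ := A.lcs_graded 1 v hv
      rw [map_add, LinearMap.add_apply]
      exact add_mem (hev _ (A.grade00 _ ha _ hX) (A.br_mem_lcs ha' _))
        (A.br_mem_lcs (hO b hb hb') _)
    | succ k hk ih =>
      intro v hv
      obtain ⟨_, ⟨a, ha, rfl⟩, _, ⟨b, hb, rfl⟩, rfl⟩ :=
        Submodule.mem_sup.1 (A.lcs_gen hnil X Y hgen k hv)
      rw [R_apply, R_apply, map_add, LinearMap.add_apply, A.der hX b Y]
      refine add_mem (A.br_mem_lcs (ih a ha) _) (add_mem (A.br_mem_lcs (ih b hb) _) ?_)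
      exact A.br_mem hb hYX2 (by omega)
  have hS : ∀ k, 1 ≤ k → A.lcs (k + 1) ≤ (A.lcs k).map (A.R Y) := by
    intro k hk
    refine A.le_of_nakayama hnil (k + 1) fun j hj => ?_
    obtain ⟨j, rfl⟩ : ∃ i, j = i + 1 := ⟨j - 1, by omega⟩
    intro v hv
    obtain ⟨_, ⟨a, ha, rfl⟩, _, ⟨b, hb, rfl⟩, rfl⟩ :=
      Submodule.mem_sup.1 (A.lcs_gen hnil X Y hgen j hv)
    refine add_mem (Submodule.mem_sup_right (hD j (by omega) a ha))
      (Submodule.mem_sup_left ⟨b, A.lcs_mono (by omega) hb, rfl⟩)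
  have hWn : W ∉ A.lcs0 1 := by
    intro h
    refine hW2 (A.lcs0_one_le (fun u hu v hv => ?_) h)
    obtain ⟨α, u', hu0, hu1, rfl⟩ := hgen.even hX hY hu
    obtain ⟨β, v', hv0, hv1, rfl⟩ := hgen.even hX hY hv
    simp only [map_add, map_smul, LinearMap.add_apply, LinearMap.smul_apply]
    refine add_mem (Submodule.smul_mem _ _ (add_mem (Submodule.smul_mem _ _ hZ2) ?_))
      (add_mem (Submodule.smul_mem _ _ ?_) ?_)
    · exact A.br_mem_lcs hu1 _
    · exact A.br_mem (A.mem_lcs_zero X) hv1 (by omega)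
    · exact A.br_mem_lcs hu1 _
  have := finrank_le_of_cyclic (M := A.L0 ⊓ A.lcs 1) (A.R W) W (n - 2) ?_
    (fun z hz => hchar0 W hW0 hWn z hz.1)
  · omega
  rintro v ⟨hv0, hv⟩
  obtain ⟨c, hc⟩ := hthin 1 le_rfl W hWs hW2 v hv
  have hc0 : v - c • W ∈ A.L0 := sub_mem hv0 (Submodule.smul_mem _ _ hW0)
  have hc3 := hev _ hc0 hc
  obtain ⟨b, hb, hbe⟩ := hS 2 (by norm_num) hc3
  obtain ⟨d, hd, rfl⟩ := hS 1 (by norm_num) hb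
  obtain ⟨d0, hd0, hd0', d1, hd1, hd1', rfl⟩ := A.lcs_graded 1 d hd
  refine ⟨c, (2⁻¹ : ℂ) • d0, ⟨Submodule.smul_mem _ _ hd0, Submodule.smul_mem _ _ hd0'⟩, ?_⟩
  have e : v - c • W = A.br (A.br d0 Y) Y := by
    refine (A.comp_unique (b := 0) (b' := A.br (A.br d1 Y) Y) hc0
      (A.grade11 _ (A.grade01 _ hd0 _ hY) _ hY) (zero_mem _)
      (A.grade01 _ (A.grade11 _ hd1 _ hY) _ hY) ?_).1
    rw [add_zero, ← hbe]
    simp only [R_apply, map_add, LinearMap.add_apply]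
  rw [R_apply, hW, map_smul, LinearMap.smul_apply, A.sq_odd hY, smul_smul]
  norm_num
  rw [← e]
  abel

/-- Case II: `R_X` acts on the odd part as a single Jordan block and the odd part of the square
is not contained in the cube. -/
lemma case_two [FiniteDimensional ℂ V] (hnil : A.IsNilpotent) {X Y : V} (hX : X ∈ A.L0)
    (hY : Y ∈ A.L1) (hgen : A.Gen2 X Y) (hthin : A.ThinTail) (n : ℕ)
    (hn : 3 ≤ n) (hM : n ≤ Module.finrank ℂ (A.L0 ⊓ A.lcs 1 : Submodule ℂ V) + 1)
    (hOD : ∀ o ∈ A.L1, o ∈ A.lcs 1 → ∃ l ∈ A.L1, o = A.br l X)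
    {o : V} (ho1 : o ∈ A.L1) (hos : o ∈ A.lcs 1) (ho2 : o ∉ A.lcs 2) : False := by
  have hMne : A.L0 ⊓ A.lcs 1 ≠ ⊥ := by
    intro h
    rw [h, finrank_bot] at hM
    omega
  obtain ⟨k, hk, hMk, hMk'⟩ := A.exists_last hnil hMne 2
    (fun v hv => hthin.even le_rfl ho1 hos ho2 hv.1 hv.2)
  set D := A.R X with hDdef
  have hDa : ∀ v, D v = A.br v X := fun v => rfl
  set y : ℕ → V := fun i => (D ^ i) Y with hy
  have hys : ∀ i, A.br (y i) X = y (i + 1) := by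
    intro i
    simp only [hy, pow_succ', Module.End.mul_apply]
    rfl
  have hy0 : y 0 = Y := by simp [hy]
  have hy1 : ∀ i, y i ∈ A.L1 := by
    intro i
    induction i with
    | zero => rwa [hy0]
    | succ i ih => rw [← hys]; exact A.grade10 _ ih _ hX
  have hyl : ∀ i, y i ∈ A.lcs i := by
    intro i
    induction i with
    | zero => exact A.mem_lcs_zero _
    | succ i ih => rw [← hys]; exact A.br_mem_lcs ih _
  have hodd : ∀ j, 1 ≤ j → j ≤ k → ∀ v ∈ A.L1, v ∈ A.lcs j →
      ∃ c : ℂ, v - c • y j ∈ A.lcs (j + 1) := by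
    intro j hj
    induction j, hj using Nat.le_induction with
    | base =>
      intro _ v hv hv1
      obtain ⟨l, hl, rfl⟩ := hOD v hv hv1
      obtain ⟨c, l', hl', hl1, rfl⟩ := hgen.odd hX hY hl
      refine ⟨c, ?_⟩
      have : A.br (c • Y + l') X - c • y 1 = A.br l' X := by
        rw [← hys 0, hy0]; simp
      rw [this]
      exact A.br_mem_lcs hl1 _
    | succ j hj ih =>
      intro hjk v hv hv1
      obtain ⟨a, ha, ha', b, hb, hb', rfl⟩ := A.gen_odd hnil hX hY hgen hv1 hv
      obtain ⟨c, hc⟩ := ih (by omega) a ha ha'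
      refine ⟨c, ?_⟩
      have : A.br a X + A.br b Y - c • y (j + 1) = A.br (a - c • y j) X + A.br b Y := by
        rw [← hys]; simp; abel
      rw [this]
      refine add_mem (A.br_mem_lcs hc _) (A.lcs_mono ?_ (A.br_mem_lcs
        (hMk ⟨hb, A.lcs_mono hj hb'⟩) _))
      omega
  set u := A.br (y (k - 1)) Y with hu
  have hu0 : u ∈ A.L0 := A.grade11 _ (hy1 _) _ hY
  have hus : u ∈ A.lcs k := hMk ⟨hu0, A.br_mem_lcs (A.mem_lcs_zero _) _⟩
  have hun : u ∉ A.lcs (k + 1) := by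
    intro hun
    obtain ⟨v, ⟨hv0, hv1⟩, hvk⟩ := SetLike.not_le_iff_exists.1 hMk'
    apply hvk
    have hvk' := hMk ⟨hv0, hv1⟩
    obtain ⟨a, ha, ha', b, hb, hb', rfl⟩ := A.gen_even (k := k - 1) hnil hX hY hgen
      (by rwa [show k - 1 + 1 = k by omega]) hv0
    refine add_mem (A.br_mem_lcs (hMk ⟨ha, A.lcs_mono (by omega) ha'⟩) _) ?_
    obtain ⟨c, hc⟩ := hodd (k - 1) (by omega) (by omega) b hb hb'
    rw [show k - 1 + 1 = k by omega] at hc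
    have h1 := A.br_mem_lcs hc Y
    have h2 := add_mem h1 (Submodule.smul_mem _ c hun)
    rw [hu, map_sub, map_smul, LinearMap.sub_apply, LinearMap.smul_apply, sub_add_cancel] at h2
    exact h2
  have hodd1 : ∀ v ∈ A.L1, v ∈ A.lcs k → v ∈ A.lcs (k + 1) := fun v hv hvk =>
    hthin.odd (by omega) hu0 hus hun hv hvk
  have huY : A.br u Y ∈ A.lcs (k + 2) := by
    have h := A.sq_odd hY (y (k - 1))
    have hW : A.br Y Y ∈ A.lcs k :=
      hMk ⟨A.grade11 _ hY _ hY, A.br_mem_lcs (A.mem_lcs_zero _) _⟩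
    have h1 : A.br (y (k - 1)) (A.br Y Y) ∈ A.lcs (k + 2) := A.br_mem (hyl _) hW (by omega)
    rw [h] at h1
    exact (Submodule.smul_mem_iff _ two_ne_zero).1 h1
  have hodd2 : ∀ v ∈ A.L1, v ∈ A.lcs (k + 1) → v ∈ A.lcs (k + 2) := by
    intro v hv hvk
    obtain ⟨a, ha, ha', b, hb, hb', rfl⟩ := A.gen_odd hnil hX hY hgen hvk hv
    refine add_mem (A.br_mem_lcs (hodd1 a ha ha') _) ?_
    obtain ⟨c, hc⟩ := hthin k (by omega) u hus hun b hb'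
    have h2 := add_mem (A.br_mem_lcs hc Y) (Submodule.smul_mem _ c huY)
    rwa [map_sub, map_smul, LinearMap.sub_apply, LinearMap.smul_apply, sub_add_cancel] at h2
  have hyk : y k ∈ A.lcs (k + 2) := hodd2 _ (hy1 k) (hodd1 _ (hy1 k) (hyl k))
  have hf : ∀ b c, A.br (A.br (y b) (y c)) X = A.br (y (b + 1)) (y c) + A.br (y b) (y (c + 1)) := by
    intro b c
    rw [A.der hX, hys, hys]
  have hff : ∀ b c, A.br (y b) (y c) ∈ A.lcs k := fun b c =>
    hMk ⟨A.grade11 _ (hy1 _) _ (hy1 _), A.br_mem_lcs (A.mem_lcs_zero _) _⟩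
  have hlow : ∀ c b, b + c = k - 1 →
      A.br (y b) (y c) - ((-1 : ℂ) ^ c) • u ∈ A.lcs (k + 1) := by
    intro c
    induction c with
    | zero =>
      intro b hb
      obtain rfl : b = k - 1 := by omega
      simp [hy0, hu]
    | succ c ih =>
      intro b hb
      have h1 := ih (b + 1) (by omega)
      have h2 := A.br_mem_lcs (hff b c) X
      rw [hf] at h2
      have h3 := sub_mem h2 h1
      convert h3 using 1
      rw [pow_succ]
      module
  have hhigh : ∀ c b, b + c = k →
      A.br (y b) (y c) + ((-1 : ℂ) ^ c * c) • A.br u X ∈ A.lcs (k + 2) := by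
    intro c
    induction c with
    | zero =>
      intro b hb
      obtain rfl : b = k := by omega
      simpa using A.lcs_succ_le_self _ (A.br_mem_lcs hyk _)
    | succ c ih =>
      intro b hb
      have h1 := ih (b + 1) (by omega)
      have h2 := A.br_mem_lcs (hlow c b (by omega)) X
      rw [map_sub, map_smul, LinearMap.sub_apply, LinearMap.smul_apply, hf] at h2
      have h3 := sub_mem h2 h1
      convert h3 using 1
      rw [pow_succ]
      push_cast
      module
  have huX : A.br u X ∈ A.lcs (k + 2) := by
    have h1 := hhigh k 0 (by omega)
    have h2 : A.br (y 0) (y k) ∈ A.lcs (k + 2) := A.br_mem (hyl 0) hyk (by omega)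
    have h3 := sub_mem h1 h2
    rw [add_sub_cancel_left] at h3
    refine (Submodule.smul_mem_iff _ ?_).1 h3
    refine mul_ne_zero (pow_ne_zero _ (by norm_num)) ?_
    exact_mod_cast (by omega : k ≠ 0)
  have hstab : A.lcs (k + 1) ≤ A.lcs (k + 2) := by
    intro v hv
    obtain ⟨v0, hv0, hv0', v1, hv1, hv1', rfl⟩ := A.lcs_graded _ v hv
    refine add_mem ?_ (hodd2 _ hv1 hv1')
    obtain ⟨a, ha, ha', b, hb, hb', rfl⟩ := A.gen_even hnil hX hY hgen hv0' hv0
    refine add_mem ?_ (A.br_mem_lcs (hodd1 b hb hb') _)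
    obtain ⟨c, hc⟩ := hthin k (by omega) u hus hun a ha'
    have h2 := add_mem (A.br_mem_lcs hc X) (Submodule.smul_mem _ c huX)
    rwa [map_sub, map_smul, LinearMap.sub_apply, LinearMap.smul_apply, sub_add_cancel] at h2
  have hbot := A.lcs_stable hnil _ hstab
  have := finrank_le_of_cyclic (M := A.L0 ⊓ A.lcs 1) 0 u 1 ?_ (by simp)
  · omega
  intro v hv
  obtain ⟨c, hc⟩ := hthin k (by omega) u hus hun v (hMk hv)
  rw [hbot, Submodule.mem_bot, sub_eq_zero] at hc
  exact ⟨c, 0, zero_mem _, by simpa using hc⟩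

/-- Case of a single generator. -/
lemma case_single [FiniteDimensional ℂ V] (hnil : A.IsNilpotent) {Y : V}
    (hY : Y ∈ A.L1) (n : ℕ) (hn : 3 ≤ n) (hM : n = Module.finrank ℂ A.L0)
    (hgen : ∀ v ∈ A.L1, ∃ c : ℂ, ∃ w ∈ A.lcs 1, v = c • Y + w)
    (hchar0 : ∀ x ∈ A.L0, x ∉ A.lcs0 1 → ∀ z ∈ A.L0, ((A.R x) ^ (n - 2)) z = 0)
    (h0 : A.L0 ≤ A.lcs 1) : False := by
  have hgen2 : A.Gen2 0 Y := by
    intro v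
    obtain ⟨a, ha, b, hb, rfl⟩ := A.exists_comp v
    obtain ⟨c, w, hw, rfl⟩ := hgen b hb
    exact ⟨0, c, a + w, add_mem (h0 ha) hw, by simp; abel⟩
  have hX : (0 : V) ∈ A.L0 := zero_mem _
  set W := A.br Y Y with hW
  have hW0 : W ∈ A.L0 := A.grade11 _ hY _ hY
  have hWn : W ∉ A.lcs0 1 := by
    intro h
    have h3 : W ∈ A.lcs 3 := A.lcs0_one_le (fun u hu v hv => A.br_mem (h0 hu) (h0 hv) le_rfl) h
    have hst : A.lcs 1 ≤ A.lcs 2 := by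
      intro v hv
      obtain ⟨_, ⟨a, ha, rfl⟩, _, ⟨b, hb, rfl⟩, rfl⟩ :=
        Submodule.mem_sup.1 (A.lcs_gen hnil 0 Y hgen2 0 hv)
      obtain ⟨α, β, w, hw, rfl⟩ := hgen2 b
      simp only [R_apply, map_zero, zero_add, map_add, map_smul, smul_zero, LinearMap.add_apply,
        LinearMap.smul_apply]
      exact add_mem (Submodule.smul_mem _ _ (A.lcs_succ_le_self _ h3)) (A.br_mem_lcs hw _)
    rw [A.lcs_stable hnil 1 hst] at h0
    rw [le_bot_iff.1 h0, finrank_bot] at hM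
    omega
  have := finrank_le_of_cyclic (M := A.L0) (A.R W) W (n - 2) ?_
    (fun z hz => hchar0 W hW0 hWn z hz)
  · omega
  intro v hv
  obtain ⟨a, ha, -, b, hb, -, rfl⟩ := A.gen_even hnil hX hY hgen2 (h0 hv) hv
  obtain ⟨β, w, hw1, hws, rfl⟩ := hgen2.odd hX hY hb
  obtain ⟨a', -, -, d, hd, -, rfl⟩ := A.gen_odd hnil hX hY hgen2 hws hw1
  refine ⟨β, (2⁻¹ : ℂ) • d, Submodule.smul_mem _ _ hd, ?_⟩
  rw [R_apply, hW, map_smul, LinearMap.smul_apply, A.sq_odd hY, smul_smul]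
  norm_num

variable (A) in
lemma finrank_chain [FiniteDimensional ℂ V] (hnil : A.IsNilpotent) (i d : ℕ)
    (h : A.lcs (i + d) ≠ ⊥) :
    Module.finrank ℂ (A.lcs (i + d)) + d ≤ Module.finrank ℂ (A.lcs i) := by
  induction d with
  | zero => simp
  | succ d ih =>
    have hne : A.lcs (i + d) ≠ ⊥ := fun h' => h (le_bot_iff.1 (h' ▸ A.lcs_succ_le_self (i + d)))
    have hlt : A.lcs (i + d + 1) < A.lcs (i + d) :=
      lt_of_le_of_ne (A.lcs_succ_le_self _) fun e => hne (A.lcs_stable hnil _ e.ge)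
    have := Submodule.finrank_lt_finrank_of_lt hlt
    have := ih hne
    rw [← add_assoc i d 1]
    omega

end aux
end LeibnizSuperAlg

/-- A nilpotent complex Leibniz superalgebra with `dim L₀ = n ≥ 3`,
`dim L₁ = m ≥ 1`, characteristic sequence `(n₁,…,n_k | m)` with `n₁ ≤ n−2`
(i.e. `(R_x|L₀)^{n−2} = 0` for all `x ∈ L₀ \ L₀²`, and some `x ∈ L₀ \ L₀²` acts on
`L₁` by a single Jordan block of size `m`) has nilindex less than `n + m`,
i.e. `L^{n+m−1} = 0`. -/
theorem statement0 {V : Type*} [AddCommGroup V] [Module ℂ V] [FiniteDimensional ℂ V]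
    (A : LeibnizSuperAlg V) (n m : ℕ)
    (hn : Module.finrank ℂ A.L0 = n) (hm : Module.finrank ℂ A.L1 = m)
    (hn3 : 3 ≤ n) (hm1 : 1 ≤ m)
    (hnil : A.IsNilpotent)
    (hchar0 : ∀ x ∈ A.L0, x ∉ A.lcs0 1 → ∀ z ∈ A.L0, ((A.R x) ^ (n - 2)) z = 0)
    (hchar1 : ∃ x ∈ A.L0, x ∉ A.lcs0 1 ∧
      (∃ z ∈ A.L1, ((A.R x) ^ (m - 1)) z ≠ 0) ∧ (∀ z ∈ A.L1, ((A.R x) ^ m) z = 0)) :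
    A.lcs (n + m - 2) = ⊥ := by
  classical
  by_contra hbot
  obtain ⟨x, hx, hxn, ⟨z, hz, hz1⟩, hz0⟩ := hchar1
  have hcyc := LeibnizSuperAlg.cyclic_of_pow_ne (A.R x) m hm hm1
    (fun w hw => A.grade10 _ hw _ hx) z hz hz1 hz0
  have hV : Module.finrank ℂ V = n + m := by
    rw [← Submodule.finrank_add_eq_of_isCompl A.compl, hn, hm]
  -- the odd part is not inside the square
  have hL1 : ¬ A.L1 ≤ A.lcs 1 := by
    intro h
    have := A.eq_bot_of_le hnil 1 h (fun j _ hj => ?_)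
    · rw [this, finrank_bot] at hm
      omega
    have h2 : A.lcs (0 + 1) ≤ A.L0 ⊔ (A.L1 ⊓ A.lcs (j + 1)) := by
      refine A.lcs_succ_le fun u _ v => ?_
      obtain ⟨a, ha, b, hb, rfl⟩ := A.exists_comp u
      obtain ⟨c, hc, d, hd, rfl⟩ := A.exists_comp v
      refine Submodule.mem_sup.2 ⟨A.br a c + A.br b d,
        add_mem (A.grade00 a ha c hc) (A.grade11 b hb d hd), A.br a d + A.br b c,
        ⟨add_mem (A.grade01 a ha d hd) (A.grade10 b hb c hc),
          add_mem (A.br_mem (A.mem_lcs_zero _) (hj hd) (by omega))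
            (A.br_mem_lcs (hj hb) _)⟩, ?_⟩
      simp only [map_add, LinearMap.add_apply]
      abel
    intro v hv
    obtain ⟨a, ha, b, hb, e⟩ := Submodule.mem_sup.1 (h2 (h hv))
    have := (A.comp_unique ha (zero_mem _) hb.1 hv (by rw [e, zero_add])).2
    exact this ▸ hb.2
  have hEl : ∀ w, A.R x w ∈ A.lcs 1 := fun w => A.br_mem_lcs (A.mem_lcs_zero _) _
  have hz_not : z ∉ A.lcs 1 := by
    intro h
    apply hL1
    intro v hv
    obtain ⟨c, w, hw, rfl⟩ := hcyc v hv
    exact add_mem (Submodule.smul_mem _ _ h) (hEl w)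
  have hOD : ∀ o ∈ A.L1, o ∈ A.lcs 1 → ∃ l ∈ A.L1, o = A.br l x := by
    intro o ho ho1
    obtain ⟨c, w, hw, rfl⟩ := hcyc o ho
    have h2 := sub_mem ho1 (hEl w)
    rw [add_sub_cancel_right] at h2
    have hc : c = 0 := by
      by_contra hc
      exact hz_not ((Submodule.smul_mem_iff _ hc).1 h2)
    exact ⟨w, hw, by rw [hc, zero_smul, zero_add]; rfl⟩
  by_cases hL0 : A.L0 ≤ A.lcs 1
  · refine LeibnizSuperAlg.case_single hnil hz n hn3 hn.symm (fun v hv => ?_) hchar0 hL0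
    obtain ⟨c, w, hw, rfl⟩ := hcyc v hv
    exact ⟨c, _, hEl w, rfl⟩
  obtain ⟨X, hX, hX1⟩ := SetLike.not_le_iff_exists.1 hL0
  -- dimension count
  have hfin1 : n + m ≤ Module.finrank ℂ (A.lcs 1) + 2 := by
    have h := A.finrank_chain hnil 1 (n + m - 3) (by rwa [show 1 + (n + m - 3) = n + m - 2 by omega])
    have h2 : 0 < Module.finrank ℂ (A.lcs (1 + (n + m - 3))) := by
      rw [Module.finrank_pos_iff, Submodule.nontrivial_iff_ne_bot]
      rwa [show 1 + (n + m - 3) = n + m - 2 by omega]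
    omega
  have hstrict : ∀ X ∈ A.L0, X ∉ A.lcs 1 → A.lcs 1 < A.lcs 1 ⊔ Submodule.span ℂ {X} ∧
      A.lcs 1 ⊔ Submodule.span ℂ {X} <
        A.lcs 1 ⊔ Submodule.span ℂ {X} ⊔ Submodule.span ℂ {z} := by
    intro X hX hX1
    constructor
    · refine SetLike.lt_iff_le_and_exists.2 ⟨le_sup_left, X, ?_, hX1⟩
      exact Submodule.mem_sup_right (Submodule.mem_span_singleton_self X)
    · refine SetLike.lt_iff_le_and_exists.2 ⟨le_sup_left, z, ?_, ?_⟩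
      · exact Submodule.mem_sup_right (Submodule.mem_span_singleton_self z)
      · intro h
        obtain ⟨p, hp, q, hq, e⟩ := Submodule.mem_sup.1 h
        obtain ⟨c, rfl⟩ := Submodule.mem_span_singleton.1 hq
        have hp' : p = -(c • X) + z := by rw [← e]; abel
        rw [hp'] at hp
        exact hz_not (A.even_part (neg_mem (Submodule.smul_mem _ _ hX)) hz hp).2
  have hfin2 : Module.finrank ℂ (A.lcs 1) + 2 ≤ n + m := by
    have h1 := Submodule.finrank_lt_finrank_of_lt (hstrict X hX hX1).1
    have h2 := Submodule.finrank_lt_finrank_of_lt (hstrict X hX hX1).2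
    have h3 := Submodule.finrank_le (A.lcs 1 ⊔ Submodule.span ℂ {X} ⊔ Submodule.span ℂ {z})
    omega
  have hgen : ∀ X ∈ A.L0, X ∉ A.lcs 1 → A.Gen2 X z := by
    intro X hX hX1 v
    have h1 := Submodule.finrank_lt_finrank_of_lt (hstrict X hX hX1).1
    have h2 := Submodule.finrank_lt_finrank_of_lt (hstrict X hX hX1).2
    have h3 := Submodule.finrank_le (A.lcs 1 ⊔ Submodule.span ℂ {X} ⊔ Submodule.span ℂ {z})
    have htop : A.lcs 1 ⊔ Submodule.span ℂ {X} ⊔ Submodule.span ℂ {z} = ⊤ :=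
      Submodule.eq_top_of_finrank_eq (by omega)
    have hv : v ∈ A.lcs 1 ⊔ Submodule.span ℂ {X} ⊔ Submodule.span ℂ {z} := by
      rw [htop]; trivial
    obtain ⟨p, hp, q, hq, rfl⟩ := Submodule.mem_sup.1 hv
    obtain ⟨β, rfl⟩ := Submodule.mem_span_singleton.1 hq
    obtain ⟨w, hw, r, hr, rfl⟩ := Submodule.mem_sup.1 hp
    obtain ⟨α, rfl⟩ := Submodule.mem_span_singleton.1 hr
    exact ⟨α, β, w, hw, by abel⟩
  have hthin : A.ThinTail := by
    intro k hk u hu hu1 v hv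
    have hkne : A.lcs k ≠ ⊥ := by
      intro h
      rw [h, Submodule.mem_bot] at hu
      exact hu1 (hu ▸ zero_mem _)
    have hup : Module.finrank ℂ (A.lcs k) + (k - 1) ≤ Module.finrank ℂ (A.lcs 1) := by
      have := A.finrank_chain hnil 1 (k - 1) (by rwa [show 1 + (k - 1) = k by omega])
      rwa [show 1 + (k - 1) = k by omega] at this
    have hle : Module.finrank ℂ (A.lcs k) ≤ Module.finrank ℂ (A.lcs (k + 1)) + 1 := by
      by_cases hk2 : k + 1 ≤ n + m - 2
      · have he : k + 1 + (n + m - 2 - (k + 1)) = n + m - 2 := by omega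
        have h := A.finrank_chain hnil (k + 1) (n + m - 2 - (k + 1)) (by rwa [he])
        rw [he] at h
        have h2 : 0 < Module.finrank ℂ (A.lcs (n + m - 2)) := by
          rw [Module.finrank_pos_iff, Submodule.nontrivial_iff_ne_bot]
          exact hbot
        omega
      · omega
    have hlt : A.lcs (k + 1) < A.lcs (k + 1) ⊔ Submodule.span ℂ {u} :=
      SetLike.lt_iff_le_and_exists.2 ⟨le_sup_left, u,
        Submodule.mem_sup_right (Submodule.mem_span_singleton_self u), hu1⟩
    have hsub : A.lcs (k + 1) ⊔ Submodule.span ℂ {u} ≤ A.lcs k :=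
      sup_le (A.lcs_succ_le_self k) (by simpa using hu)
    have heq := Submodule.eq_of_le_of_finrank_le hsub
      (by have := Submodule.finrank_lt_finrank_of_lt hlt; omega)
    rw [← heq] at hv
    obtain ⟨p, hp, q, hq, rfl⟩ := Submodule.mem_sup.1 hv
    obtain ⟨c, rfl⟩ := Submodule.mem_span_singleton.1 hq
    exact ⟨c, by rwa [add_sub_cancel_right]⟩
  have hM : n ≤ Module.finrank ℂ (A.L0 ⊓ A.lcs 1 : Submodule ℂ V) + 1 := by
    have hle : A.L0 ≤ (A.L0 ⊓ A.lcs 1) ⊔ Submodule.span ℂ {X} := by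
      intro v hv
      obtain ⟨α, w, hw, hw1, rfl⟩ := (hgen X hX hX1).even hX hz hv
      exact add_mem (Submodule.mem_sup_right (Submodule.smul_mem _ _
        (Submodule.mem_span_singleton_self X))) (Submodule.mem_sup_left ⟨hw, hw1⟩)
    have h1 := Submodule.finrank_mono hle
    have h2 := Submodule.finrank_add_le_finrank_add_finrank (A.L0 ⊓ A.lcs 1)
      (Submodule.span ℂ {X})
    have h3 : Module.finrank ℂ (Submodule.span ℂ {X}) ≤ 1 := by
      simpa using finrank_span_le_card (R := ℂ) ({X} : Set V)
    omega
  by_cases hO : ∀ o ∈ A.L1, o ∈ A.lcs 1 → o ∈ A.lcs 2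
  · exact LeibnizSuperAlg.case_one hnil hX hz hX1 (hgen X hX hX1) hthin n hn3 hM hchar0 hO
  · push Not at hO
    obtain ⟨o, ho1, hos, ho2⟩ := hO
    have hx1 : x ∉ A.lcs 1 := by
      intro h
      obtain ⟨l, hl, rfl⟩ := hOD o ho1 hos
      exact ho2 (A.br_mem (A.mem_lcs_zero l) h (by omega))
    exact LeibnizSuperAlg.case_two hnil hx hz (hgen x hx hx1) hthin n hn3 hM hOD ho1 hos ho2
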